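/- arXiv:2602.07324 — 6 statements merged into one kernel-verified Lean document; each statement's English description precedes it below -/
import Mathlib

section
/- Injective normal form is unique: if X and Y are parameterized states both in injective normal form (INF), and X and Y are semantically equivalent (for every subset A of 𝒜, every (φ, σ) ∈ X with A ∈ φ and every (φ', σ') ∈ Y with A ∈ φ' satisfy σ = σ'), then X = Y as sets of rules. -/
/-- Partition property: every `A ⊆ 𝒜` belongs to the condition of exactly one
rule. -/
def PartitionProp {𝒜 St : Type*} (X : Set (Set (Set 𝒜) × St)) : Prop :=
  ∀ A : Set 𝒜, ∃! r : Set (Set 𝒜) × St, r ∈ X ∧ A ∈ r.1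

/-- Injective normal form: partition property, distinct rules have distinct
results, and no rule has empty condition. -/
def INF {𝒜 St : Type*} (X : Set (Set (Set 𝒜) × St)) : Prop :=
  PartitionProp X ∧
    (∀ r₁ ∈ X, ∀ r₂ ∈ X, r₁.2 = r₂.2 → r₁ = r₂) ∧
    ∀ r ∈ X, r.1 ≠ (∅ : Set (Set 𝒜))

/-- Each rule of a state in INF is a rule of every semantically equivalent state in INF. -/
theorem INF.subset_of_equiv {𝒜 St : Type*}
    {X Y : Set (Set (Set 𝒜) × St)} (hX : INF X) (hY : INF Y)
    (hequiv : ∀ A : Set 𝒜, ∀ r ∈ X, A ∈ r.1 → ∀ s ∈ Y, A ∈ s.1 → r.2 = s.2) :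
    X ⊆ Y := by
  intro r hr
  obtain ⟨A, hA⟩ := Set.nonempty_iff_ne_empty.2 (hX.2.2 r hr)
  obtain ⟨s, ⟨hs, hAs⟩, -⟩ := hY.1 A
  have hrs : r.2 = s.2 := hequiv A r hr hA s hs hAs
  have hcond : r.1 = s.1 := by
    ext B
    constructor
    · intro hB
      obtain ⟨t, ⟨ht, hBt⟩, -⟩ := hY.1 B
      rwa [← hY.2.1 t ht s hs ((hequiv B r hr hB t ht hBt).symm.trans hrs)]
    · intro hB
      obtain ⟨t, ⟨ht, hBt⟩, -⟩ := hX.1 B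
      rwa [← hX.2.1 t ht r hr ((hequiv B t ht hBt s hs hB).trans hrs.symm)]
  rwa [Prod.ext hcond hrs]

/-- **Uniqueness of INF**: semantically equivalent states in INF are equal. -/
theorem INF_unique {𝒜 St : Type*}
    (X Y : Set (Set (Set 𝒜) × St)) (hX : INF X) (hY : INF Y)
    (hequiv : ∀ A : Set 𝒜, ∀ φ σ, (φ, σ) ∈ X → A ∈ φ →
      ∀ φ' σ', (φ', σ') ∈ Y → A ∈ φ' → σ = σ') :
    X = Y := by
  apply Set.Subset.antisymm
  · exact hX.subset_of_equiv hY fun A r hr hA s hs hAs =>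
      hequiv A r.1 r.2 hr hA s.1 s.2 hs hAs
  · exact hY.subset_of_equiv hX fun A r hr hA s hs hAs =>
      (hequiv A s.1 s.2 hs hAs r.1 r.2 hr hA).symm
end

section
/- For every parameterized state X with the partition property, there exists a unique parameterized state Y in injective normal form (INF) that is semantically equivalent to X, i.e. such that for every subset A of 𝒜, every rule (φ, σ) ∈ X with A ∈ φ and every rule (φ', σ') ∈ Y with A ∈ φ' satisfy σ = σ'. -/
/-- Semantic equivalence of parameterized states. -/
def SemEquiv {𝒜 St : Type*} (X Y : Set (Set (Set 𝒜) × St)) : Prop :=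
  ∀ A : Set 𝒜, ∀ φ σ, (φ, σ) ∈ X → A ∈ φ →
    ∀ φ' σ', (φ', σ') ∈ Y → A ∈ φ' → σ = σ'

/-- A parameterized state with the partition property is semantically a function from sets of
labels to analysis states. -/
theorem PartitionProp.exists_semantics {𝒜 St : Type*} {X : Set (Set (Set 𝒜) × St)}
    (hX : PartitionProp X) :
    ∃ f : Set 𝒜 → St, ∀ A σ, (∃ φ, (φ, σ) ∈ X ∧ A ∈ φ) ↔ f A = σ := by
  choose r hr hu using hX
  refine ⟨fun A => (r A).2, fun A σ => ⟨?_, ?_⟩⟩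
  · rintro ⟨φ, hφ, hA⟩
    exact congrArg Prod.snd (hu A (φ, σ) ⟨hφ, hA⟩).symm
  · rintro rfl
    exact ⟨(r A).1, (hr A).1, (hr A).2⟩

/-- The parameterized state whose conditions are the nonempty fibres of `f`. -/
def fibreState {𝒜 St : Type*} (f : Set 𝒜 → St) : Set (Set (Set 𝒜) × St) :=
  Set.range fun A => (f ⁻¹' {f A}, f A)

theorem INF_fibreState {𝒜 St : Type*} (f : Set 𝒜 → St) : INF (fibreState f) := by
  refine ⟨fun A => ⟨(f ⁻¹' {f A}, f A), ⟨⟨A, rfl⟩, rfl⟩, ?_⟩, ?_, ?_⟩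
  · rintro _ ⟨⟨B, rfl⟩, hA⟩
    have h : f A = f B := hA
    simp only [h]
  · rintro _ ⟨A, rfl⟩ _ ⟨B, rfl⟩ h
    have h' : f A = f B := h
    simp only [h']
  · rintro _ ⟨A, rfl⟩
    exact Set.Nonempty.ne_empty ⟨A, rfl⟩

/-- A parameterized state in INF is determined by the function it denotes. -/
theorem INF.eq_fibreState {𝒜 St : Type*} {Y : Set (Set (Set 𝒜) × St)} (hY : INF Y)
    {f : Set 𝒜 → St} (hf : ∀ A φ σ, (φ, σ) ∈ Y → A ∈ φ → f A = σ) : Y = fibreState f := by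
  obtain ⟨hP, hinj, hne⟩ := hY
  have fibre : ∀ φ σ, (φ, σ) ∈ Y → φ = f ⁻¹' {σ} := by
    intro φ σ h
    ext B
    refine ⟨fun hB => hf B φ σ h hB, fun hB => ?_⟩
    obtain ⟨⟨ψ, τ⟩, ⟨hψ, hBψ⟩, -⟩ := hP B
    have hτ : τ = σ := (hf B ψ τ hψ hBψ).symm.trans hB
    have hψφ : ψ = φ := congrArg Prod.fst (hinj _ hψ _ h hτ)
    exact hψφ ▸ hBψ
  ext ⟨φ, σ⟩
  constructor
  · intro h
    obtain ⟨A, hA⟩ := Set.nonempty_iff_ne_empty.2 (hne _ h)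
    obtain rfl := hf A φ σ h hA
    exact ⟨A, by rw [fibre φ _ h]⟩
  · rintro ⟨A, hA⟩
    obtain ⟨⟨ψ, τ⟩, ⟨hψ, hAψ⟩, -⟩ := hP A
    obtain rfl := hf A ψ τ hψ hAψ
    rw [← hA]
    beta_reduce
    rwa [← fibre ψ _ hψ]

/-- **Existence and uniqueness of INF reduction**: every parameterized state
with the partition property is semantically equivalent to a unique state in
INF. -/
theorem INF_exists_unique {𝒜 St : Type*}
    (X : Set (Set (Set 𝒜) × St)) (hX : PartitionProp X) :
    ∃! Y : Set (Set (Set 𝒜) × St), INF Y ∧ SemEquiv X Y := by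
  obtain ⟨f, hf⟩ := hX.exists_semantics
  refine ⟨fibreState f, ⟨INF_fibreState f, ?_⟩, ?_⟩
  · rintro A φ σ hφ hA _ _ ⟨B, hB⟩ hA'
    obtain ⟨rfl, rfl⟩ := Prod.mk.inj hB
    exact ((hf A σ).1 ⟨φ, hφ, hA⟩).symm.trans hA'
  · rintro Y ⟨hY, hXY⟩
    refine hY.eq_fibreState fun A ψ τ hψ hA => ?_
    obtain ⟨φ, hφ, hAφ⟩ := (hf A (f A)).2 rfl
    exact hXY A φ (f A) hφ hAφ ψ τ hψ hA
end

section
/- Splitting on an assumption preserves the partition property: let Σ be a meet-semilattice, a ∈ 𝒜, π_a ∈ Σ, and let X be a parameterized state with the partition property. Then split_a(X) again has the partition property: for every subset A of 𝒜 there is exactly one rule (φ', σ') ∈ split_a(X) with A ∈ φ'. -/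
/-- The split of a parameterized state `X` on the assumption `a` with
associated state `πa`. -/
def splitOn {𝒜 St : Type*} [SemilatticeInf St] (a : 𝒜) (πa : St)
    (X : Set (Set (Set 𝒜) × St)) : Set (Set (Set 𝒜) × St) :=
  {p | ∃ r ∈ X, r.1 ∩ {A : Set 𝒜 | a ∈ A} ≠ ∅ ∧
        p = (r.1 ∩ {A : Set 𝒜 | a ∈ A}, r.2 ⊓ πa)} ∪
  {p | ∃ r ∈ X, r.1 ∩ {A : Set 𝒜 | a ∉ A} ≠ ∅ ∧
        p = (r.1 ∩ {A : Set 𝒜 | a ∉ A}, r.2)}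

/-- **Splitting preserves the partition property.** -/
theorem splitOn_partition {𝒜 St : Type*} [SemilatticeInf St]
    (a : 𝒜) (πa : St) (X : Set (Set (Set 𝒜) × St)) (hX : PartitionProp X) :
    PartitionProp (splitOn a πa X) := by
  intro A
  obtain ⟨r, ⟨hr, hA⟩, huniq⟩ := hX A
  by_cases ha : a ∈ A
  · refine ⟨(r.1 ∩ {A : Set 𝒜 | a ∈ A}, r.2 ⊓ πa),
      ⟨Or.inl ⟨r, hr, Set.Nonempty.ne_empty ⟨A, hA, ha⟩, rfl⟩, hA, ha⟩, ?_⟩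
    rintro p ⟨⟨s, hs, -, rfl⟩ | ⟨s, hs, -, rfl⟩, hAs, has⟩
    · rw [huniq s ⟨hs, hAs⟩]
    · exact absurd ha has
  · refine ⟨(r.1 ∩ {A : Set 𝒜 | a ∉ A}, r.2),
      ⟨Or.inr ⟨r, hr, Set.Nonempty.ne_empty ⟨A, hA, ha⟩, rfl⟩, hA, ha⟩, ?_⟩
    rintro p ⟨⟨s, hs, -, rfl⟩ | ⟨s, hs, -, rfl⟩, hAs, has⟩
    · exact absurd has ha
    · rw [huniq s ⟨hs, hAs⟩]
end

section
/- Approximate Merging yields an over-approximation: let Σ be a join-semilattice and X a parameterized state with the partition property, and let (φ₁, σ₁) and (φ₂, σ₂) be two distinct rules of X. Let X' = (X \ {(φ₁,σ₁), (φ₂,σ₂)}) ∪ {(φ₁ ∪ φ₂, σ₁ ⊔ σ₂)}. Then X' has the partition property, and for every subset A of 𝒜, every rule (φ, τ) ∈ X with A ∈ φ, and every rule (φ', τ') ∈ X' with A ∈ φ', one has τ ≤ τ'. -/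
/-- Two rules of a parameterized state with the partition property whose conditions share an
element are equal. -/
theorem PartitionProp.eq_of_mem {𝒜 St : Type*} {X : Set (Set (Set 𝒜) × St)}
    (hX : PartitionProp X) {A : Set 𝒜} {r s : Set (Set 𝒜) × St}
    (hr : r ∈ X) (hAr : A ∈ r.1) (hs : s ∈ X) (hAs : A ∈ s.1) : r = s :=
  (hX A).unique ⟨hr, hAr⟩ ⟨hs, hAs⟩

/-- **Approximate Merging yields an over-approximation.** -/
theorem approximate_merging_overapprox {𝒜 St : Type*} [SemilatticeSup St]
    (X : Set (Set (Set 𝒜) × St)) (hX : PartitionProp X)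
    (φ₁ φ₂ : Set (Set 𝒜)) (σ₁ σ₂ : St)
    (h₁ : (φ₁, σ₁) ∈ X) (h₂ : (φ₂, σ₂) ∈ X) (hne : (φ₁, σ₁) ≠ (φ₂, σ₂))
    (X' : Set (Set (Set 𝒜) × St))
    (hX' : X' = (X \ {(φ₁, σ₁), (φ₂, σ₂)}) ∪ {(φ₁ ∪ φ₂, σ₁ ⊔ σ₂)}) :
    PartitionProp X' ∧
      ∀ A : Set 𝒜, ∀ φ τ, (φ, τ) ∈ X → A ∈ φ →
        ∀ φ' τ', (φ', τ') ∈ X' → A ∈ φ' → τ ≤ τ' := by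
  subst hX'
  constructor
  · intro A
    by_cases hA : A ∈ φ₁ ∪ φ₂
    · refine ⟨(φ₁ ∪ φ₂, σ₁ ⊔ σ₂), ⟨Or.inr rfl, hA⟩, ?_⟩
      rintro s ⟨⟨hs, hs_ne⟩ | hs, hAs⟩
      · refine absurd ?_ hs_ne
        rcases hA with hA | hA
        · exact Or.inl (hX.eq_of_mem hs hAs h₁ hA)
        · exact Or.inr (hX.eq_of_mem hs hAs h₂ hA)
      · exact hs
    · obtain ⟨r, ⟨hr, hAr⟩, huniq⟩ := hX A
      refine ⟨r, ⟨Or.inl ⟨hr, ?_⟩, hAr⟩, ?_⟩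
      · rintro (rfl | rfl)
        · exact hA (Or.inl hAr)
        · exact hA (Or.inr hAr)
      · rintro s ⟨⟨hs, -⟩ | rfl, hAs⟩
        · exact huniq s ⟨hs, hAs⟩
        · exact absurd hAs hA
  · rintro A φ τ hr hAφ φ' τ' (⟨hs, -⟩ | hs) hAφ'
    · exact (congrArg Prod.snd (hX.eq_of_mem hr hAφ hs hAφ')).le
    · obtain ⟨rfl, rfl⟩ := Prod.mk.inj hs
      rcases hAφ' with hA | hA
      · exact (congrArg Prod.snd (hX.eq_of_mem hr hAφ h₁ hA)).le.trans le_sup_left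
      · exact (congrArg Prod.snd (hX.eq_of_mem hr hAφ h₂ hA)).le.trans le_sup_right
end

section
/- Semantic equivalence of parameterized states is characterized by equality of their INF reductions: if X and Y are parameterized states with the partition property, and X̂ and Ŷ are parameterized states in injective normal form (INF) semantically equivalent to X and Y respectively, then X and Y are semantically equivalent if and only if X̂ = Ŷ. -/
theorem SemEquiv.symm {𝒜 St : Type*} {X Y : Set (Set (Set 𝒜) × St)}
    (h : SemEquiv X Y) : SemEquiv Y X :=
  fun A φ σ hr hA φ' σ' hr' hA' => (h A φ' σ' hr' hA' φ σ hr hA).symm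

theorem SemEquiv.trans {𝒜 St : Type*} {X Y Z : Set (Set (Set 𝒜) × St)}
    (hY : PartitionProp Y) (hXY : SemEquiv X Y) (hYZ : SemEquiv Y Z) : SemEquiv X Z := by
  intro A φ σ hr hA φ' σ' hr' hA'
  obtain ⟨⟨ψ, τ⟩, ⟨hs, hAs⟩, -⟩ := hY A
  exact (hXY A φ σ hr hA ψ τ hs hAs).trans (hYZ A ψ τ hs hAs φ' σ' hr' hA')

/-- A rule of a state in INF applies wherever a rule with the same result applies in a
semantically equivalent state. -/
theorem SemEquiv.condition_subset {𝒜 St : Type*} {X Y : Set (Set (Set 𝒜) × St)}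
    (h : SemEquiv X Y) (hY : INF Y) {φ ψ : Set (Set 𝒜)} {σ : St}
    (hφ : (φ, σ) ∈ X) (hψ : (ψ, σ) ∈ Y) : φ ⊆ ψ := by
  intro A hA
  obtain ⟨⟨χ, τ⟩, ⟨hs, hAs⟩, -⟩ := hY.1 A
  have hτ : σ = τ := h A φ σ hφ hA χ τ hs hAs
  have hχ : χ = ψ := congrArg Prod.fst (hY.2.1 (χ, τ) hs (ψ, σ) hψ hτ.symm)
  exact hχ ▸ hAs

theorem SemEquiv.subset_of_INF {𝒜 St : Type*} {X Y : Set (Set (Set 𝒜) × St)}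
    (h : SemEquiv X Y) (hX : INF X) (hY : INF Y) : X ⊆ Y := by
  rintro ⟨φ, σ⟩ hφ
  obtain ⟨A, hA⟩ := Set.nonempty_iff_ne_empty.mpr (hX.2.2 _ hφ)
  obtain ⟨⟨ψ, τ⟩, ⟨hψ, hAψ⟩, -⟩ := hY.1 A
  obtain rfl : σ = τ := h A φ σ hφ hA ψ τ hψ hAψ
  obtain rfl : φ = ψ :=
    (h.condition_subset hY hφ hψ).antisymm (h.symm.condition_subset hX hψ hφ)
  exact hψ

/-- **Semantic equivalence is characterized by equality of INF reductions.** -/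
theorem semEquiv_iff_INF_eq {𝒜 St : Type*}
    (X Y Xhat Yhat : Set (Set (Set 𝒜) × St))
    (hX : PartitionProp X) (hY : PartitionProp Y)
    (hXhat : INF Xhat) (hYhat : INF Yhat)
    (hXeq : SemEquiv X Xhat) (hYeq : SemEquiv Y Yhat) :
    SemEquiv X Y ↔ Xhat = Yhat := by
  constructor
  · intro h
    have hhat : SemEquiv Xhat Yhat := (hXeq.symm.trans hX h).trans hY hYeq
    exact (hhat.subset_of_INF hXhat hYhat).antisymm (hhat.symm.subset_of_INF hYhat hXhat)
  · rintro rfl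
    exact hXeq.trans hXhat.1 hYeq.symm
end

section
/- Merging preserves uniqueness of the applicable rule even when the merged rule collides with an existing rule: let Σ be a join-semilattice, X a parameterized state with the partition property, and (φ₁, σ₁), (φ₂, σ₂) two distinct rules of X. Then for every subset A of 𝒜, there is exactly one rule of X' = (X \ {(φ₁,σ₁), (φ₂,σ₂)}) ∪ {(φ₁ ∪ φ₂, σ₁ ⊔ σ₂)} whose condition contains A; moreover, if A ∉ φ₁ ∪ φ₂, the result of that unique rule equals the result of the unique rule of X applying to A. -/
/-- **Approximate Merging preserves uniqueness of the applicable rule**, even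
when the merged rule collides with an existing rule; moreover outside of
`φ₁ ∪ φ₂` the result of the unique applicable rule is unchanged. -/
theorem merging_unique_rule {𝒜 St : Type*} [SemilatticeSup St]
    (X : Set (Set (Set 𝒜) × St)) (hX : PartitionProp X)
    (φ₁ φ₂ : Set (Set 𝒜)) (σ₁ σ₂ : St)
    (h₁ : (φ₁, σ₁) ∈ X) (h₂ : (φ₂, σ₂) ∈ X) (hne : (φ₁, σ₁) ≠ (φ₂, σ₂))
    (X' : Set (Set (Set 𝒜) × St))
    (hX' : X' = (X \ {(φ₁, σ₁), (φ₂, σ₂)}) ∪ {(φ₁ ∪ φ₂, σ₁ ⊔ σ₂)}) :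
    ∀ A : Set 𝒜,
      (∃! r : Set (Set 𝒜) × St, r ∈ X' ∧ A ∈ r.1) ∧
      (A ∉ φ₁ ∪ φ₂ →
        ∀ r ∈ X, A ∈ r.1 → ∀ r' ∈ X', A ∈ r'.1 → r.2 = r'.2) := by
  subst hX'
  intro A
  obtain ⟨r₀, ⟨hr₀, hA₀⟩, huniq⟩ := hX A
  have eq_of_mem : ∀ r ∈ X, A ∈ r.1 → r = r₀ := fun r hr hA => huniq r ⟨hr, hA⟩
  by_cases hA : A ∈ φ₁ ∪ φ₂
  · refine ⟨⟨(φ₁ ∪ φ₂, σ₁ ⊔ σ₂), ⟨Or.inr rfl, hA⟩, ?_⟩, fun h => absurd hA h⟩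
    rintro r ⟨⟨hr, hnot⟩ | hr, hAr⟩
    · refine absurd ?_ hnot
      rw [eq_of_mem r hr hAr]
      rcases hA with hA | hA
      · exact Or.inl (eq_of_mem _ h₁ hA).symm
      · exact Or.inr (eq_of_mem _ h₂ hA).symm
    · exact hr
  · have eq_of_mem_merged : ∀ r ∈ (X \ {(φ₁, σ₁), (φ₂, σ₂)}) ∪ {(φ₁ ∪ φ₂, σ₁ ⊔ σ₂)},
        A ∈ r.1 → r = r₀ := by
      rintro r (⟨hr, -⟩ | rfl) hAr
      · exact eq_of_mem r hr hAr
      · exact absurd hAr hA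
    refine ⟨⟨r₀, ⟨Or.inl ⟨hr₀, ?_⟩, hA₀⟩, fun r hr => eq_of_mem_merged r hr.1 hr.2⟩, ?_⟩
    · rintro (rfl | rfl)
      · exact hA (Or.inl hA₀)
      · exact hA (Or.inr hA₀)
    · intro _ r hr hAr r' hr' hAr'
      rw [eq_of_mem r hr hAr, eq_of_mem_merged r' hr' hAr']
end
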